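/- (Wesołowski's constant-regression characterization.) Let X and Y be two independent random variables, each positive almost surely and neither almost surely constant, with E(1/X) < ∞. Set U = 1/(X + Y) and V = 1/X − 1/(X + Y), and assume V and 1/V are integrable with E(V | U) = c almost surely and E(1/V | U) = d almost surely for real constants c and d. Then c·d > 1, and there exists a > 0 such that X follows the GIG(−p, 2a, 2b) distribution and Y follows the Γ(p, a) distribution, where p = c·d/(c·d − 1) and b = d/(c·d − 1). -/

import Mathlib

open MeasureTheory ProbabilityTheory Real Set Filter

/-- Unnormalized density of the GIG(p, a, b) distribution on (0, ∞). -/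
noncomputable def gigpdf (p a b : ℝ) (x : ℝ) : ℝ :=
  if 0 < x then x ^ (p - 1) * Real.exp (-(a * x + b / x) / 2) else 0

/-- Unnormalized density of the Gamma distribution with shape p and rate c on (0, ∞). -/
noncomputable def gampdf (p c : ℝ) (x : ℝ) : ℝ :=
  if 0 < x then x ^ (p - 1) * Real.exp (-(c * x)) else 0

/-- The law of `X` under `μ` has a Lebesgue density proportional to `g`. -/
def HasLawProp {Ω : Type*} [MeasurableSpace Ω] (μ : Measure Ω) (X : Ω → ℝ) (g : ℝ → ℝ) : Prop :=
  ∃ k : ℝ, 0 < k ∧ Measure.map X μ = volume.withDensity (fun x => ENNReal.ofReal (k * g x))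

/-- `X` follows the GIG(p, a, b) distribution under `μ`. -/
def HasLawGIG {Ω : Type*} [MeasurableSpace Ω] (μ : Measure Ω) (X : Ω → ℝ) (p a b : ℝ) : Prop :=
  HasLawProp μ X (gigpdf p a b)

/-- `X` follows the Gamma(p, c) distribution under `μ`. -/
def HasLawGamma {Ω : Type*} [MeasurableSpace Ω] (μ : Measure Ω) (X : Ω → ℝ) (p c : ℝ) : Prop :=
  HasLawProp μ X (gampdf p c)

/-- `U = 1/(X + Y)`. -/
noncomputable def uMY {Ω : Type*} (X Y : Ω → ℝ) (ω : Ω) : ℝ := 1 / (X ω + Y ω)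

/-- `V = 1/X - 1/(X + Y)`. -/
noncomputable def vMY {Ω : Type*} (X Y : Ω → ℝ) (ω : Ω) : ℝ := 1 / X ω - 1 / (X ω + Y ω)

/-- The `k`-th Laplace moment `s ↦ ∫ x ^ k * exp (-s x) dν`. -/
noncomputable def laplaceMoment (ν : Measure ℝ) (k : ℕ) (s : ℝ) : ℝ :=
  ∫ x, x ^ k * Real.exp (-(s * x)) ∂ν

lemma neg_mem_interior_integrableExpSet {ν : Measure ℝ} [IsFiniteMeasure ν]
    (hν : ∀ᵐ x ∂ν, 0 < x) {s : ℝ} (hs : 0 < s) :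
    -s ∈ interior (integrableExpSet id ν) := by
  have hsub : Iio (0 : ℝ) ⊆ integrableExpSet id ν := by
    intro t ht
    refine Integrable.mono' (integrable_const (1 : ℝ)) (by fun_prop) ?_
    filter_upwards [hν] with x hx
    rw [Real.norm_eq_abs, abs_of_pos (Real.exp_pos _), Real.exp_le_one_iff]
    exact mul_nonpos_of_nonpos_of_nonneg (le_of_lt ht) hx.le
  exact interior_mono hsub (by simpa using hs)

lemma integrable_laplaceMoment {ν : Measure ℝ} [IsFiniteMeasure ν]
    (hν : ∀ᵐ x ∂ν, 0 < x) (k : ℕ) {s : ℝ} (hs : 0 < s) :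
    Integrable (fun x => x ^ k * Real.exp (-(s * x))) ν := by
  simpa using integrable_pow_mul_exp_of_mem_interior_integrableExpSet
    (neg_mem_interior_integrableExpSet hν hs) k

lemma hasDerivAt_laplaceMoment {ν : Measure ℝ} [IsFiniteMeasure ν]
    (hν : ∀ᵐ x ∂ν, 0 < x) (k : ℕ) {s : ℝ} (hs : 0 < s) :
    HasDerivAt (laplaceMoment ν k) (-laplaceMoment ν (k + 1) s) s := by
  have h := (hasDerivAt_integral_pow_mul_exp_real
    (neg_mem_interior_integrableExpSet hν hs) k).scomp s (hasDerivAt_neg s)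
  convert! h using 1
  · funext t
    simp [laplaceMoment]
  · simp [laplaceMoment]

lemma laplaceMoment_pos {ν : Measure ℝ} [IsFiniteMeasure ν] (hν : ∀ᵐ x ∂ν, 0 < x)
    (hν0 : ν ≠ 0) (k : ℕ) {s : ℝ} (hs : 0 < s) : 0 < laplaceMoment ν k s := by
  have hpos : ∀ᵐ x ∂ν, 0 < x ^ k * Real.exp (-(s * x)) := by
    filter_upwards [hν] with x hx
    positivity
  rw [laplaceMoment, integral_pos_iff_support_of_nonneg_ae
    (hpos.mono fun x hx => hx.le) (integrable_laplaceMoment hν k hs)]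
  rw [pos_iff_ne_zero]
  intro h0
  apply hν0
  rw [← Measure.measure_univ_eq_zero, ← nonpos_iff_eq_zero, ← h0]
  refine measure_mono_ae ?_
  filter_upwards [hpos] with x hx _ using hx.ne'

lemma tendsto_laplaceMoment_atTop {ν : Measure ℝ} [IsFiniteMeasure ν]
    (hν : ∀ᵐ x ∂ν, 0 < x) (k : ℕ) :
    Tendsto (laplaceMoment ν k) atTop (nhds 0) := by
  have h := tendsto_integral_filter_of_dominated_convergence (μ := ν) (l := atTop)
    (F := fun s x => x ^ k * Real.exp (-(s * x))) (f := fun _ => 0)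
    (fun x => x ^ k * Real.exp (-(1 * x))) (Eventually.of_forall fun s => by fun_prop)
    ?_ (integrable_laplaceMoment hν k one_pos) ?_
  · rwa [integral_zero] at h
  · filter_upwards [eventually_ge_atTop 1] with s hs
    filter_upwards [hν] with x hx
    rw [Real.norm_eq_abs, abs_of_pos (by positivity)]
    gcongr
  · filter_upwards [hν] with x hx
    have : Tendsto (fun s : ℝ => Real.exp (-(s * x))) atTop (nhds 0) :=
      Real.tendsto_exp_neg_atTop_nhds_zero.comp (tendsto_id.atTop_mul_const hx)
    simpa using this.const_mul (x ^ k)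

lemma complexMGF_id_withDensity_exp_neg (ν : Measure ℝ) (z : ℂ) :
    complexMGF id (ν.withDensity fun x => ENNReal.ofReal (Real.exp (-x))) z
      = complexMGF id ν (z - 1) := by
  rw [complexMGF, complexMGF, integral_withDensity_eq_integral_toReal_smul (by fun_prop)
    (by simp)]
  refine integral_congr_ae (Eventually.of_forall fun x => ?_)
  simp only [id, ENNReal.toReal_ofReal (Real.exp_pos _).le, Complex.real_smul,
    Complex.ofReal_exp, ← Complex.exp_add]
  congr 1
  push_cast
  ring

theorem ext_of_laplaceMoment_zero {ν₁ ν₂ : Measure ℝ} [IsFiniteMeasure ν₁] [IsFiniteMeasure ν₂]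
    (h₁ : ∀ᵐ x ∂ν₁, 0 < x) (h₂ : ∀ᵐ x ∂ν₂, 0 < x)
    (h : ∀ s, 0 < s → laplaceMoment ν₁ 0 s = laplaceMoment ν₂ 0 s) : ν₁ = ν₂ := by
  have hmgf (ν : Measure ℝ) (t : ℝ) : mgf id ν t = laplaceMoment ν 0 (-t) := by
    simp [mgf, laplaceMoment]
  have han (ν : Measure ℝ) [IsFiniteMeasure ν] (hν : ∀ᵐ x ∂ν, 0 < x) :
      AnalyticOnNhd ℂ (complexMGF id ν) {z | z.re < 0} := by
    refine analyticOnNhd_complexMGF.mono fun z hz => ?_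
    simpa using neg_mem_interior_integrableExpSet hν (neg_pos.2 hz)
  have heq : Set.EqOn (complexMGF id ν₁) (complexMGF id ν₂) {z : ℂ | z.re < 0} := by
    refine AnalyticOnNhd.eqOn_of_preconnected_of_frequently_eq (han ν₁ h₁) (han ν₂ h₂)
      (convex_halfSpace_re_lt 0).isPreconnected (z₀ := ((-1 : ℝ) : ℂ)) (by simp) ?_
    have htend : Tendsto (fun x : ℝ => (x : ℂ)) (nhdsWithin (-1) {-1}ᶜ)
        (nhdsWithin ((-1 : ℝ) : ℂ) {((-1 : ℝ) : ℂ)}ᶜ) :=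
      tendsto_nhdsWithin_of_tendsto_nhds_of_eventually_within _
        (Complex.continuous_ofReal.continuousAt.mono_left nhdsWithin_le_nhds)
        (eventually_nhdsWithin_of_forall fun x hx h => hx (Complex.ofReal_injective h))
    refine htend.frequently (Eventually.frequently ?_)
    filter_upwards [nhdsWithin_le_nhds (Iio_mem_nhds (show (-1 : ℝ) < 0 by norm_num))] with x hx
    rw [complexMGF_ofReal, complexMGF_ofReal, hmgf, hmgf, h _ (neg_pos.2 hx)]
  have hfin (ν : Measure ℝ) [IsFiniteMeasure ν] (hν : ∀ᵐ x ∂ν, 0 < x) :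
      IsFiniteMeasure (ν.withDensity fun x => ENNReal.ofReal (Real.exp (-x))) := by
    refine isFiniteMeasure_withDensity_ofReal ?_
    simpa using (integrable_laplaceMoment hν 0 one_pos).2
  have := hfin ν₁ h₁
  have := hfin ν₂ h₂
  have key : (ν₁.withDensity fun x => ENNReal.ofReal (Real.exp (-x)))
      = ν₂.withDensity fun x => ENNReal.ofReal (Real.exp (-x)) := by
    refine Measure.ext_of_charFun (funext fun t => ?_)
    rw [← complexMGF_id_mul_I, ← complexMGF_id_mul_I, complexMGF_id_withDensity_exp_neg,
      complexMGF_id_withDensity_exp_neg]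
    exact heq (by simp)
  have hinv (ν : Measure ℝ) : (ν.withDensity fun x => ENNReal.ofReal (Real.exp (-x))).withDensity
      (fun x => ENNReal.ofReal (Real.exp (-x)))⁻¹ = ν :=
    withDensity_inv_same (by fun_prop)
      (Eventually.of_forall fun x => by simp [Real.exp_pos])
      (Eventually.of_forall fun x => by simp)
  rw [← hinv ν₁, key, hinv ν₂]

lemma eq_of_hasDerivAt_zero_Ioi {f : ℝ → ℝ} (hf : ∀ s, 0 < s → HasDerivAt f 0 s)
    {s t : ℝ} (hs : 0 < s) (ht : 0 < t) : f s = f t :=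
  isOpen_Ioi.is_const_of_deriv_eq_zero isPreconnected_Ioi
    (fun x hx => (hf x hx).differentiableAt.differentiableWithinAt)
    (fun x hx => (hf x hx).deriv) hs ht

lemma sq_laplaceMoment_one_lt {ν : Measure ℝ} [IsFiniteMeasure ν] (hν : ∀ᵐ x ∂ν, 0 < x)
    (hnd : ¬ ∃ k : ℝ, ∀ᵐ x ∂ν, x = k) {s : ℝ} (hs : 0 < s) :
    laplaceMoment ν 1 s ^ 2 < laplaceMoment ν 0 s * laplaceMoment ν 2 s := by
  have hν0 : ν ≠ 0 := by
    rintro rfl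
    exact hnd ⟨0, by simp⟩
  have h0 := laplaceMoment_pos hν hν0 0 hs
  set r := laplaceMoment ν 1 s / laplaceMoment ν 0 s with hr
  have hsplit : (fun x => (x - r) ^ 2 * Real.exp (-(s * x))) = fun x =>
      x ^ 2 * Real.exp (-(s * x)) - 2 * r * (x ^ 1 * Real.exp (-(s * x)))
        + r ^ 2 * (x ^ 0 * Real.exp (-(s * x))) := by
    funext x
    ring
  have i0 := (integrable_laplaceMoment hν 0 hs).const_mul (r ^ 2)
  have i1 := (integrable_laplaceMoment hν 1 hs).const_mul (2 * r)
  have i2 := integrable_laplaceMoment hν 2 hs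
  have hinteg : Integrable (fun x => (x - r) ^ 2 * Real.exp (-(s * x))) ν := by
    rw [hsplit]
    exact (i2.sub i1).add i0
  have hval : ∫ x, (x - r) ^ 2 * Real.exp (-(s * x)) ∂ν =
      laplaceMoment ν 2 s - 2 * r * laplaceMoment ν 1 s + r ^ 2 * laplaceMoment ν 0 s := by
    rw [hsplit, integral_add (by exact i2.sub i1) i0, integral_sub i2 i1, integral_const_mul,
      integral_const_mul]
    rfl
  have hnn : 0 ≤ ∫ x, (x - r) ^ 2 * Real.exp (-(s * x)) ∂ν :=
    integral_nonneg fun x => by positivity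
  have hpos : 0 < ∫ x, (x - r) ^ 2 * Real.exp (-(s * x)) ∂ν := by
    refine lt_of_le_of_ne hnn fun h => hnd ⟨r, ?_⟩
    have := (integral_eq_zero_iff_of_nonneg (fun x => by positivity) hinteg).1 h.symm
    filter_upwards [this] with x hx
    have hx' : (x - r) ^ 2 * Real.exp (-(s * x)) = 0 := hx
    have := (mul_eq_zero.1 hx').resolve_right (Real.exp_pos _).ne'
    linarith [pow_eq_zero_iff two_ne_zero |>.1 this]
  rw [hval] at hpos
  have h1 : laplaceMoment ν 1 s = r * laplaceMoment ν 0 s := by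
    rw [hr]
    field_simp
  rw [h1] at hpos ⊢
  nlinarith [mul_pos h0 hpos]

/-- The Laplace-moment identities expressing the constant regressions of `V` and `1 / V` on `U`. -/
structure RegressionIdentities (νX νY : Measure ℝ) (c d : ℝ) : Prop where
  first : ∀ s, 0 < s → laplaceMoment νX 0 s * laplaceMoment νY 2 s =
    c * (laplaceMoment νX 2 s * laplaceMoment νY 1 s + laplaceMoment νX 1 s * laplaceMoment νY 2 s)
  second : ∀ s, 0 < s → laplaceMoment νX 3 s * laplaceMoment νY 0 s
    + laplaceMoment νX 2 s * laplaceMoment νY 1 s =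
    d * (laplaceMoment νX 1 s * laplaceMoment νY 1 s)

section Regression

variable {νX νY : Measure ℝ} [IsFiniteMeasure νX] [IsFiniteMeasure νY] {c d : ℝ}

lemma RegressionIdentities.integrated (h : RegressionIdentities νX νY c d)
    (hX : ∀ᵐ x ∂νX, 0 < x) (hY : ∀ᵐ x ∂νY, 0 < x) {s : ℝ} (hs : 0 < s) :
    d * (laplaceMoment νX 0 s - c * laplaceMoment νX 1 s) * laplaceMoment νY 1 s
      = laplaceMoment νX 2 s * laplaceMoment νY 0 s := by
  let W : ℝ → ℝ := fun s =>
    d * (laplaceMoment νX 0 s - c * laplaceMoment νX 1 s) * laplaceMoment νY 1 s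
      - laplaceMoment νX 2 s * laplaceMoment νY 0 s
  have hW : ∀ s, 0 < s → HasDerivAt W 0 s := by
    intro s hs
    have A := fun k => hasDerivAt_laplaceMoment hX k hs
    have B := fun k => hasDerivAt_laplaceMoment hY k hs
    have := (((A 0).fun_sub ((A 1).const_mul c)).const_mul d).fun_mul (B 1) |>.fun_sub
      ((A 2).fun_mul (B 0))
    convert! this using 1
    simp only [zero_add, Nat.reduceAdd]
    linear_combination d * h.first s hs - h.second s hs
  have hlim : Tendsto W atTop (nhds 0) := by
    have A := tendsto_laplaceMoment_atTop hX
    have B := tendsto_laplaceMoment_atTop hY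
    have := ((((A 0).sub ((A 1).const_mul c)).const_mul d).mul (B 1)).sub ((A 2).mul (B 0))
    simpa using this
  have hconst : Tendsto W atTop (nhds (W s)) := by
    refine tendsto_const_nhds.congr' ?_
    filter_upwards [eventually_gt_atTop 0] with t ht using eq_of_hasDerivAt_zero_Ioi hW hs ht
  have := tendsto_nhds_unique hconst hlim
  simp only [W] at this
  linarith

lemma RegressionIdentities.pos_right (h : RegressionIdentities νX νY c d)
    (hX : ∀ᵐ x ∂νX, 0 < x) (hY : ∀ᵐ x ∂νY, 0 < x) (hX0 : νX ≠ 0) (hY0 : νY ≠ 0) : 0 < d := by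
  have A := fun k => laplaceMoment_pos hX hX0 k one_pos
  have B := fun k => laplaceMoment_pos hY hY0 k one_pos
  have h2 := h.second 1 one_pos
  refine pos_of_mul_pos_left (b := laplaceMoment νX 1 1 * laplaceMoment νY 1 1) ?_
    (mul_pos (A 1) (B 1)).le
  rw [← h2]
  exact add_pos (mul_pos (A 3) (B 0)) (mul_pos (A 2) (B 1))

lemma RegressionIdentities.log_convexity_eq (h : RegressionIdentities νX νY c d)
    (hX : ∀ᵐ x ∂νX, 0 < x) (hY : ∀ᵐ x ∂νY, 0 < x) (hX0 : νX ≠ 0) (hY0 : νY ≠ 0)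
    {s : ℝ} (hs : 0 < s) :
    laplaceMoment νY 0 s * laplaceMoment νY 2 s = c * d * laplaceMoment νY 1 s ^ 2 := by
  have A := fun k => laplaceMoment_pos hX hX0 k hs
  have B := fun k => laplaceMoment_pos hY hY0 k hs
  have h1 := h.first s hs
  have h3 := h.integrated hX hY hs
  have hD : laplaceMoment νX 0 s - c * laplaceMoment νX 1 s ≠ 0 := by
    intro h0
    rw [h0] at h3
    have := mul_pos (A 2) (B 0)
    simp at h3
    rcases h3 with h3 | h3
    · exact (A 2).ne' h3
    · exact (B 0).ne' h3
  apply mul_left_cancel₀ hD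
  linear_combination laplaceMoment νY 0 s * h1 - c * laplaceMoment νY 1 s * h3

lemma RegressionIdentities.one_lt_mul (h : RegressionIdentities νX νY c d)
    (hX : ∀ᵐ x ∂νX, 0 < x) (hY : ∀ᵐ x ∂νY, 0 < x) (hX0 : νX ≠ 0)
    (hnd : ¬ ∃ k : ℝ, ∀ᵐ x ∂νY, x = k) : 1 < c * d := by
  have hY0 : νY ≠ 0 := by
    rintro rfl
    exact hnd ⟨0, by simp⟩
  have h1 := sq_laplaceMoment_one_lt hY hnd one_pos
  rw [h.log_convexity_eq hX hY hX0 hY0 one_pos] at h1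
  have := laplaceMoment_pos hY hY0 1 one_pos
  by_contra! hle
  nlinarith [sq_nonneg (laplaceMoment νY 1 1)]

lemma exists_laplaceMoment_zero_eq_mul {q : ℝ} (hq : 1 < q) (hY : ∀ᵐ x ∂νY, 0 < x)
    (hY0 : νY ≠ 0) (hinteg : Integrable (fun x => x) νY)
    (h : ∀ s, 0 < s → laplaceMoment νY 0 s * laplaceMoment νY 2 s = q * laplaceMoment νY 1 s ^ 2) :
    ∃ a, 0 < a ∧ ∀ s, 0 < s →
      laplaceMoment νY 0 s = (q - 1) * (s + a) * laplaceMoment νY 1 s := by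
  have B := fun k s (hs : 0 < s) => laplaceMoment_pos hY hY0 k hs
  have hd : ∀ s, 0 < s → HasDerivAt
      (fun s => laplaceMoment νY 0 s / laplaceMoment νY 1 s - (q - 1) * s) 0 s := by
    intro s hs
    have := ((hasDerivAt_laplaceMoment hY 0 hs).fun_div (hasDerivAt_laplaceMoment hY 1 hs)
      (B 1 s hs).ne').fun_sub ((hasDerivAt_id s).const_mul (q - 1))
    convert! this using 1
    have hB := (B 1 s hs).ne'
    simp only [zero_add, Nat.reduceAdd]
    field_simp
    linear_combination - h s hs
  obtain ⟨C, hC⟩ : ∃ C, ∀ s, 0 < s →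
      laplaceMoment νY 0 s / laplaceMoment νY 1 s - (q - 1) * s = C :=
    ⟨_, fun s hs => eq_of_hasDerivAt_zero_Ioi hd hs one_pos⟩
  have hB1 : ∀ s, 0 < s → laplaceMoment νY 1 s ≤ ∫ x, x ∂νY := by
    intro s hs
    refine integral_mono_ae (integrable_laplaceMoment hY 1 hs) hinteg ?_
    filter_upwards [hY] with x hx
    have : Real.exp (-(s * x)) ≤ 1 := Real.exp_le_one_iff.2 (by nlinarith)
    simpa using mul_le_of_le_one_right hx.le this
  have hB0 : ∀ s, 0 < s → s ≤ 1 → laplaceMoment νY 0 1 ≤ laplaceMoment νY 0 s := by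
    intro s hs hs1
    refine integral_mono_ae (integrable_laplaceMoment hY 0 one_pos)
      (integrable_laplaceMoment hY 0 hs) ?_
    filter_upwards [hY] with x hx
    have : Real.exp (-(1 * x)) ≤ Real.exp (-(s * x)) := by gcongr
    simpa using this
  set M := ∫ x, x ∂νY
  have hM : 0 < M := (B 1 1 one_pos).trans_le (hB1 1 one_pos)
  have hq' : 0 < q - 1 := sub_pos.2 hq
  have hCpos : 0 < C := by
    set e := laplaceMoment νY 0 1 / M
    have he : 0 < e := div_pos (B 0 1 one_pos) hM
    have hs : 0 < min 1 (e / (2 * (q - 1))) := by positivity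
    set s := min 1 (e / (2 * (q - 1)))
    have h1 : e ≤ laplaceMoment νY 0 s / laplaceMoment νY 1 s :=
      div_le_div₀ (B 0 s hs).le (hB0 s hs (min_le_left _ _)) (B 1 s hs) (hB1 s hs)
    have h2 : (q - 1) * s ≤ e / 2 := by
      have : s ≤ e / (2 * (q - 1)) := min_le_right _ _
      rw [le_div_iff₀ (by positivity)] at this
      linarith
    linarith [hC s hs]
  refine ⟨C / (q - 1), by positivity, fun s hs => ?_⟩
  have := hC s hs
  have hB := (B 1 s hs).ne'
  field_simp at this ⊢
  linear_combination this

lemma exists_laplaceMoment_one_eq_rpow {q a : ℝ} (hq : 1 < q) (ha : 0 < a)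
    (hY : ∀ᵐ x ∂νY, 0 < x) (hY0 : νY ≠ 0)
    (h : ∀ s, 0 < s → laplaceMoment νY 0 s * laplaceMoment νY 2 s = q * laplaceMoment νY 1 s ^ 2)
    (h0 : ∀ s, 0 < s → laplaceMoment νY 0 s = (q - 1) * (s + a) * laplaceMoment νY 1 s) :
    ∃ K, 0 < K ∧ ∀ s, 0 < s → laplaceMoment νY 1 s = K * (s + a) ^ (-(q / (q - 1))) := by
  have B := fun k s (hs : 0 < s) => laplaceMoment_pos hY hY0 k hs
  have hq' : 0 < q - 1 := sub_pos.2 hq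
  have hd : ∀ s, 0 < s → HasDerivAt
      (fun s => laplaceMoment νY 1 s * (s + a) ^ (q / (q - 1))) 0 s := by
    intro s hs
    have hsa : 0 < s + a := by positivity
    have := (hasDerivAt_laplaceMoment hY 1 hs).fun_mul
      (((hasDerivAt_id s).add_const a).rpow_const (p := q / (q - 1)) (Or.inl hsa.ne'))
    convert! this using 1
    have h2 : (q - 1) * (s + a) * laplaceMoment νY 2 s = q * laplaceMoment νY 1 s := by
      apply mul_left_cancel₀ (B 1 s hs).ne'
      linear_combination h s hs - laplaceMoment νY 2 s * h0 s hs
    simp only [id, Nat.reduceAdd]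
    rw [Real.rpow_sub_one hsa.ne']
    field_simp
    linear_combination (s + a) ^ (q / (q - 1)) * h2
  refine ⟨laplaceMoment νY 1 1 * (1 + a) ^ (q / (q - 1)),
    mul_pos (B 1 1 one_pos) (by positivity), fun s hs => ?_⟩
  have hsa : 0 < s + a := by positivity
  have := eq_of_hasDerivAt_zero_Ioi hd hs one_pos
  rw [← this, mul_assoc, ← Real.rpow_add hsa]
  simp

/-- Decaying solutions of `(s + a) f'' = b f + p f'` are unique up to a constant factor. -/
lemma exists_laplaceMoment_one_eq_mul {ν₁ ν₂ : Measure ℝ} [IsFiniteMeasure ν₁] [IsFiniteMeasure ν₂]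
    (h₁ : ∀ᵐ x ∂ν₁, 0 < x) (h₂ : ∀ᵐ x ∂ν₂, 0 < x) (h₁0 : ν₁ ≠ 0) (h₂0 : ν₂ ≠ 0)
    {a b p : ℝ} (ha : 0 < a) (hp : 0 < p)
    (e₁ : ∀ s, 0 < s → (s + a) * laplaceMoment ν₁ 2 s =
      b * laplaceMoment ν₁ 0 s - p * laplaceMoment ν₁ 1 s)
    (e₂ : ∀ s, 0 < s → (s + a) * laplaceMoment ν₂ 2 s =
      b * laplaceMoment ν₂ 0 s - p * laplaceMoment ν₂ 1 s) :
    ∃ K, 0 < K ∧ ∀ s, 0 < s → laplaceMoment ν₁ 1 s = K * laplaceMoment ν₂ 1 s := by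
  have A := fun k s (hs : 0 < s) => laplaceMoment_pos h₁ h₁0 k hs
  have B := fun k s (hs : 0 < s) => laplaceMoment_pos h₂ h₂0 k hs
  let W : ℝ → ℝ := fun s => (laplaceMoment ν₁ 1 s * laplaceMoment ν₂ 0 s
    - laplaceMoment ν₁ 0 s * laplaceMoment ν₂ 1 s) * (s + a) ^ (-p)
  have hWd : ∀ s, 0 < s → HasDerivAt W 0 s := by
    intro s hs
    have hsa : 0 < s + a := by positivity
    have dA := fun k => hasDerivAt_laplaceMoment h₁ k hs
    have dB := fun k => hasDerivAt_laplaceMoment h₂ k hs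
    have := (((dA 1).fun_mul (dB 0)).fun_sub ((dA 0).fun_mul (dB 1))).fun_mul
      (((hasDerivAt_id s).add_const a).rpow_const (p := -p) (Or.inl hsa.ne'))
    convert! this using 1
    simp only [id, Nat.reduceAdd, zero_add]
    rw [Real.rpow_sub_one hsa.ne']
    field_simp
    linear_combination (s + a) ^ (-p) *
      (laplaceMoment ν₂ 0 s * e₁ s hs - laplaceMoment ν₁ 0 s * e₂ s hs)
  have hWlim : Tendsto W atTop (nhds 0) := by
    have lA := tendsto_laplaceMoment_atTop h₁
    have lB := tendsto_laplaceMoment_atTop h₂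
    have lp : Tendsto (fun s : ℝ => (s + a) ^ (-p)) atTop (nhds 0) :=
      (tendsto_rpow_neg_atTop hp).comp (tendsto_atTop_add_const_right _ _ tendsto_id)
    simpa using (((lA 1).mul (lB 0)).sub ((lA 0).mul (lB 1))).mul lp
  have hW0 : ∀ s, 0 < s → laplaceMoment ν₁ 1 s * laplaceMoment ν₂ 0 s =
      laplaceMoment ν₁ 0 s * laplaceMoment ν₂ 1 s := by
    intro s hs
    have hconst : Tendsto W atTop (nhds (W s)) := by
      refine tendsto_const_nhds.congr' ?_
      filter_upwards [eventually_gt_atTop 0] with t ht using eq_of_hasDerivAt_zero_Ioi hWd hs ht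
    have hz := (mul_eq_zero.1 (tendsto_nhds_unique hconst hWlim)).resolve_right
      (Real.rpow_pos_of_pos (by positivity) _).ne'
    linarith
  have hd : ∀ s, 0 < s → HasDerivAt
      (fun s => laplaceMoment ν₁ 0 s / laplaceMoment ν₂ 0 s) 0 s := by
    intro s hs
    have := (hasDerivAt_laplaceMoment h₁ 0 hs).fun_div (hasDerivAt_laplaceMoment h₂ 0 hs)
      (B 0 s hs).ne'
    convert! this using 1
    have hB := (B 0 s hs).ne'
    simp only [zero_add]
    field_simp
    linear_combination hW0 s hs
  refine ⟨laplaceMoment ν₁ 0 1 / laplaceMoment ν₂ 0 1,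
    div_pos (A 0 1 one_pos) (B 0 1 one_pos), fun s hs => ?_⟩
  have := eq_of_hasDerivAt_zero_Ioi hd hs one_pos
  rw [← this]
  have hB := (B 0 s hs).ne'
  field_simp
  linear_combination hW0 s hs

end Regression

lemma hasLawProp_of_laplace {Ω : Type*} [MeasurableSpace Ω] {μ : Measure Ω} [IsProbabilityMeasure μ]
    {X : Ω → ℝ} (hXm : Measurable X) (hXpos : ∀ᵐ ω ∂μ, 0 < X ω) {g : ℝ → ℝ} (hgm : Measurable g)
    (hg0 : ∀ x, x ≤ 0 → g x = 0) (hgnn : ∀ x, 0 ≤ g x) (hgi : IntegrableOn g (Ioi 0))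
    {K : ℝ} (hK : 0 < K)
    (h : ∀ s, 0 < s → ∫ ω, Real.exp (-(s * X ω)) ∂μ = K * ∫ x in Ioi 0, Real.exp (-(s * x)) * g x) :
    HasLawProp μ X g := by
  refine ⟨K, hK, ?_⟩
  have hgi' : Integrable (fun x => K * g x) := by
    refine Integrable.const_mul ?_ K
    rw [← integrableOn_univ, ← Iic_union_Ioi (a := (0 : ℝ)), integrableOn_union]
    refine ⟨integrableOn_zero.congr_fun (fun x hx => (hg0 x hx).symm) measurableSet_Iic, hgi⟩
  have : IsFiniteMeasure (volume.withDensity fun x => ENNReal.ofReal (K * g x)) :=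
    isFiniteMeasure_withDensity_ofReal hgi'.2
  have := Measure.isProbabilityMeasure_map (μ := μ) hXm.aemeasurable
  refine ext_of_laplaceMoment_zero ?_ ?_ fun s hs => ?_
  · rwa [ae_map_iff hXm.aemeasurable measurableSet_Ioi]
  · rw [ae_withDensity_iff (by fun_prop)]
    refine Eventually.of_forall fun x hx => ?_
    by_contra! hle
    simp [hg0 x hle] at hx
  · rw [laplaceMoment, laplaceMoment, integral_map hXm.aemeasurable (by fun_prop),
      integral_withDensity_eq_integral_toReal_smul (by fun_prop) (by simp)]
    simp only [pow_zero, one_mul]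
    rw [h s hs, ← integral_const_mul, setIntegral_eq_integral_of_forall_compl_eq_zero]
    · refine integral_congr_ae (Eventually.of_forall fun x => ?_)
      simp only [smul_eq_mul]
      rw [ENNReal.toReal_ofReal (mul_nonneg hK.le (hgnn x))]
      ring
    · intro x hx
      simp [hg0 x (not_lt.1 hx)]

lemma exp_neg_div_le {b x : ℝ} (hb : 0 < b) (hx : 0 < x) (n : ℕ) :
    Real.exp (-(b / x)) ≤ n.factorial / b ^ n * x ^ n := by
  have h := Real.pow_div_factorial_le_exp (b / x) (by positivity) n
  rw [Real.exp_neg, inv_le_comm₀ (Real.exp_pos _) (by positivity)]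
  refine le_trans (le_of_eq ?_) h
  rw [div_pow]
  field_simp

lemma integrableOn_rpow_mul_exp_gig {a b : ℝ} (ha : 0 < a) (hb : 0 < b) (r : ℝ) :
    IntegrableOn (fun x => x ^ r * Real.exp (-(a * x + b / x))) (Ioi 0) := by
  obtain ⟨n, hn⟩ := exists_nat_gt (-1 - r)
  have hdom : IntegrableOn (fun x : ℝ => n.factorial / b ^ n * (x ^ (r + n) * Real.exp (-a * x)))
      (Ioi 0) := by
    have := integrableOn_rpow_mul_exp_neg_mul_rpow (s := r + n) (p := 1) (b := a)
      (by linarith) one_pos ha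
    simp only [Real.rpow_one] at this
    exact this.const_mul _
  refine Integrable.mono' hdom (by fun_prop) ?_
  filter_upwards [ae_restrict_mem measurableSet_Ioi] with x hx
  have hx : 0 < x := hx
  rw [Real.norm_eq_abs, abs_of_pos (by positivity), neg_add, Real.exp_add]
  calc x ^ r * (Real.exp (-(a * x)) * Real.exp (-(b / x)))
      ≤ x ^ r * (Real.exp (-(a * x)) * (n.factorial / b ^ n * x ^ n)) := by
        gcongr
        exact exp_neg_div_le hb hx n
    _ = _ := by
        rw [Real.rpow_add hx, Real.rpow_natCast, neg_mul]
        ring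

lemma integral_gig_recurrence {a b p : ℝ} (ha : 0 < a) (hb : 0 < b) (hp : 0 < p) :
    a * ∫ x in Ioi 0, x ^ (-p) * Real.exp (-(a * x + b / x)) =
      b * (∫ x in Ioi 0, x ^ (-p - 2) * Real.exp (-(a * x + b / x)))
        - p * ∫ x in Ioi 0, x ^ (-p - 1) * Real.exp (-(a * x + b / x)) := by
  let F : ℝ → ℝ := fun x => x ^ (-p) * Real.exp (-(a * x + b / x))
  have i0 := (integrableOn_rpow_mul_exp_gig ha hb (-p)).const_mul a
  have i1 := (integrableOn_rpow_mul_exp_gig ha hb (-p - 1)).const_mul p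
  have i2 := (integrableOn_rpow_mul_exp_gig ha hb (-p - 2)).const_mul b
  have hF0 : F 0 = 0 := by simp [F, Real.zero_rpow (neg_ne_zero.2 hp.ne')]
  have hcont : ContinuousWithinAt F (Ici 0) 0 := by
    obtain ⟨n, hn⟩ := exists_nat_gt p
    rw [ContinuousWithinAt, hF0]
    have hlim : Tendsto (fun x : ℝ => n.factorial / b ^ n * x ^ (n - p))
        (nhdsWithin 0 (Ici 0)) (nhds 0) := by
      have : ContinuousAt (fun x : ℝ => n.factorial / b ^ n * x ^ (n - p)) 0 :=
        (Real.continuousAt_rpow_const _ _ (Or.inr (by linarith))).const_mul _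
      have h := this.tendsto
      rw [Real.zero_rpow (by linarith), mul_zero] at h
      exact h.mono_left nhdsWithin_le_nhds
    refine squeeze_zero' ?_ ?_ hlim
    · filter_upwards [self_mem_nhdsWithin] with x hx
      exact mul_nonneg (Real.rpow_nonneg hx _) (Real.exp_pos _).le
    · filter_upwards [self_mem_nhdsWithin] with x hx
      rcases eq_or_lt_of_le (show 0 ≤ x from hx) with rfl | hx
      · rw [hF0, Real.zero_rpow (by linarith), mul_zero]
      · calc F x ≤ x ^ (-p) * Real.exp (-(b / x)) := by
              simp only [F]
              gcongr
              nlinarith [mul_pos ha hx]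
          _ ≤ x ^ (-p) * (n.factorial / b ^ n * x ^ n) := by
              gcongr
              exact exp_neg_div_le hb hx n
          _ = _ := by
              rw [sub_eq_add_neg, Real.rpow_add hx, Real.rpow_natCast]
              ring
  have htop : Tendsto F atTop (nhds 0) := by
    refine squeeze_zero' (g := fun x => x ^ (-p)) ?_ ?_ (tendsto_rpow_neg_atTop hp)
    · filter_upwards [eventually_gt_atTop 0] with x hx
      positivity
    · filter_upwards [eventually_gt_atTop 0] with x hx
      refine mul_le_of_le_one_right (by positivity) (Real.exp_le_one_iff.2 ?_)
      have : 0 < a * x + b / x := by positivity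
      linarith
  have hderiv : ∀ x ∈ Ioi (0 : ℝ), HasDerivAt F
      (b * (x ^ (-p - 2) * Real.exp (-(a * x + b / x)))
        - p * (x ^ (-p - 1) * Real.exp (-(a * x + b / x)))
        - a * (x ^ (-p) * Real.exp (-(a * x + b / x)))) x := by
    intro x hx
    have hx : 0 < x := hx
    have := ((hasDerivAt_id x).rpow_const (p := -p) (Or.inl hx.ne')).fun_mul
      ((((hasDerivAt_id x).const_mul a).fun_add
        ((hasDerivAt_const x b).fun_div (hasDerivAt_id x) hx.ne')).fun_neg.exp)
    convert! this using 1
    simp only [id]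
    rw [Real.rpow_sub_one hx.ne', show -p - 2 = -p - 1 - 1 by ring, Real.rpow_sub_one hx.ne',
      Real.rpow_sub_one hx.ne']
    field_simp
    ring
  have key := integral_Ioi_of_hasDerivAt_of_tendsto hcont hderiv ((i2.sub i1).sub i0) htop
  rw [integral_sub (by exact i2.sub i1) i0, integral_sub i2 i1, integral_const_mul,
    integral_const_mul, integral_const_mul, hF0] at key
  linarith

/-- The finite measure with density `x ^ (-p - 2) * exp (-(a x + b / x))` on `(0, ∞)`. -/
noncomputable def gigKernelMeasure (p a b : ℝ) : Measure ℝ :=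
  (volume.restrict (Ioi 0)).withDensity fun x =>
    ENNReal.ofReal (x ^ (-p - 2) * Real.exp (-(a * x + b / x)))

lemma isFiniteMeasure_gigKernelMeasure (p : ℝ) {a b : ℝ} (ha : 0 < a) (hb : 0 < b) :
    IsFiniteMeasure (gigKernelMeasure p a b) :=
  isFiniteMeasure_withDensity_ofReal (integrableOn_rpow_mul_exp_gig ha hb _).2

lemma gigKernelMeasure_pos (p a b : ℝ) : ∀ᵐ x ∂gigKernelMeasure p a b, 0 < x :=
  (withDensity_absolutelyContinuous _ _).ae_le (ae_restrict_mem measurableSet_Ioi)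

lemma gigKernelMeasure_ne_zero (p a b : ℝ) : gigKernelMeasure p a b ≠ 0 := by
  intro h
  rw [gigKernelMeasure, withDensity_eq_zero_iff (by fun_prop)] at h
  have h' : ∀ᵐ x ∂volume.restrict (Ioi (0 : ℝ)), False := by
    filter_upwards [h, ae_restrict_mem measurableSet_Ioi] with x hx hx0
    have hx0 : 0 < x := hx0
    have : 0 < x ^ (-p - 2) * Real.exp (-(a * x + b / x)) := by positivity
    exact this.not_ge (ENNReal.ofReal_eq_zero.1 hx)
  rw [ae_iff] at h'
  simp at h'

lemma laplaceMoment_gigKernelMeasure (p a b : ℝ) (k : ℕ) (s : ℝ) :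
    laplaceMoment (gigKernelMeasure p a b) k s =
      ∫ x in Ioi 0, x ^ (-p - 2 + k) * Real.exp (-((s + a) * x + b / x)) := by
  rw [laplaceMoment, gigKernelMeasure,
    integral_withDensity_eq_integral_toReal_smul (by fun_prop) (by simp)]
  refine setIntegral_congr_fun measurableSet_Ioi fun x hx => ?_
  have hx : 0 < x := hx
  simp only [smul_eq_mul]
  rw [ENNReal.toReal_ofReal (by positivity), Real.rpow_add hx, Real.rpow_natCast]
  have : Real.exp (-((s + a) * x + b / x)) =
      Real.exp (-(a * x + b / x)) * Real.exp (-(s * x)) := by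
    rw [← Real.exp_add]
    ring_nf
  rw [this]
  ring

lemma laplaceMoment_gigKernelMeasure_recurrence {p a b : ℝ} (ha : 0 < a) (hb : 0 < b) (hp : 0 < p)
    {s : ℝ} (hs : 0 < s) :
    (s + a) * laplaceMoment (gigKernelMeasure p a b) 2 s =
      b * laplaceMoment (gigKernelMeasure p a b) 0 s
        - p * laplaceMoment (gigKernelMeasure p a b) 1 s := by
  have := integral_gig_recurrence (add_pos hs ha) hb hp
  rw [laplaceMoment_gigKernelMeasure, laplaceMoment_gigKernelMeasure,
    laplaceMoment_gigKernelMeasure]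
  convert! this using 6 <;> (push_cast; ring_nf)

/-- The law of `X` reweighted by `1 / x`. -/
noncomputable def invWeightedLaw {Ω : Type*} [MeasurableSpace Ω] (μ : Measure Ω) (X : Ω → ℝ) :
    Measure ℝ :=
  (μ.map X).withDensity fun x => ENNReal.ofReal (1 / x)

section InvWeightedLaw

variable {Ω : Type*} [MeasurableSpace Ω] {μ : Measure Ω} {X : Ω → ℝ}

lemma invWeightedLaw_pos (hXm : Measurable X) (hXpos : ∀ᵐ ω ∂μ, 0 < X ω) :
    ∀ᵐ x ∂invWeightedLaw μ X, 0 < x :=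
  (withDensity_absolutelyContinuous _ _).ae_le
    ((ae_map_iff hXm.aemeasurable measurableSet_Ioi).2 hXpos)

lemma isFiniteMeasure_invWeightedLaw (hXm : Measurable X)
    (hXinv : Integrable (fun ω => 1 / X ω) μ) : IsFiniteMeasure (invWeightedLaw μ X) := by
  refine isFiniteMeasure_withDensity_ofReal ?_
  exact ((integrable_map_measure (by fun_prop) hXm.aemeasurable).2 hXinv).2

lemma invWeightedLaw_nondegenerate (hXm : Measurable X) (hXpos : ∀ᵐ ω ∂μ, 0 < X ω)
    (hXnd : ¬ ∃ k : ℝ, ∀ᵐ ω ∂μ, X ω = k) : ¬ ∃ k : ℝ, ∀ᵐ x ∂invWeightedLaw μ X, x = k := by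
  rintro ⟨k, hk⟩
  refine hXnd ⟨k, ?_⟩
  rw [invWeightedLaw, ae_withDensity_iff (by fun_prop)] at hk
  filter_upwards [ae_of_ae_map hXm.aemeasurable hk, hXpos] with ω h hpos
  exact h (by simpa using hpos)

lemma invWeightedLaw_ne_zero (hXm : Measurable X) (hXpos : ∀ᵐ ω ∂μ, 0 < X ω)
    (hXnd : ¬ ∃ k : ℝ, ∀ᵐ ω ∂μ, X ω = k) : invWeightedLaw μ X ≠ 0 := by
  intro h
  exact invWeightedLaw_nondegenerate hXm hXpos hXnd ⟨0, by simp [h]⟩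

lemma integrable_invWeightedLaw_iff (hXm : Measurable X) (hXpos : ∀ᵐ ω ∂μ, 0 < X ω) {f : ℝ → ℝ}
    (hf : Measurable f) :
    Integrable f (invWeightedLaw μ X) ↔ Integrable (fun ω => 1 / X ω * f (X ω)) μ := by
  rw [invWeightedLaw, integrable_withDensity_iff_integrable_smul' (by fun_prop) (by simp),
    integrable_map_measure (by fun_prop) hXm.aemeasurable]
  refine integrable_congr ?_
  filter_upwards [hXpos] with ω hω
  simp only [Function.comp_apply, smul_eq_mul]
  rw [ENNReal.toReal_ofReal (by positivity)]

lemma integral_invWeightedLaw (hXm : Measurable X) (hXpos : ∀ᵐ ω ∂μ, 0 < X ω) {f : ℝ → ℝ}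
    (hf : Measurable f) :
    ∫ x, f x ∂invWeightedLaw μ X = ∫ ω, 1 / X ω * f (X ω) ∂μ := by
  rw [invWeightedLaw, integral_withDensity_eq_integral_toReal_smul (by fun_prop) (by simp),
    integral_map hXm.aemeasurable (by fun_prop)]
  refine integral_congr_ae ?_
  filter_upwards [hXpos] with ω hω
  simp only [smul_eq_mul]
  rw [ENNReal.toReal_ofReal (by positivity)]

lemma laplaceMoment_one_invWeightedLaw (hXm : Measurable X) (hXpos : ∀ᵐ ω ∂μ, 0 < X ω) (s : ℝ) :
    laplaceMoment (invWeightedLaw μ X) 1 s = ∫ ω, Real.exp (-(s * X ω)) ∂μ := by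
  rw [laplaceMoment, integral_invWeightedLaw hXm hXpos (by fun_prop)]
  refine integral_congr_ae ?_
  filter_upwards [hXpos] with ω hω
  field_simp

end InvWeightedLaw

lemma integral_mul_of_condExp_comap_eq_const {Ω : Type*} [MeasurableSpace Ω] {μ : Measure Ω}
    [IsProbabilityMeasure μ] {U f : Ω → ℝ} (hU : Measurable U) (hf : Integrable f μ) {c : ℝ}
    (h : μ[f | MeasurableSpace.comap U inferInstance] =ᵐ[μ] fun _ => c)
    {φ : ℝ → ℝ} (hφ : Measurable φ) {M : ℝ} (hM : ∀ᵐ ω ∂μ, ‖φ (U ω)‖ ≤ M) :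
    ∫ ω, φ (U ω) * f ω ∂μ = c * ∫ ω, φ (U ω) ∂μ := by
  have hm : MeasurableSpace.comap U inferInstance ≤ ‹MeasurableSpace Ω› := hU.comap_le
  have hsm : StronglyMeasurable[MeasurableSpace.comap U inferInstance] (fun ω => φ (U ω)) :=
    (hφ.comp (comap_measurable U)).stronglyMeasurable
  have key := condExp_stronglyMeasurable_mul_of_bound hm hsm hf M hM
  calc ∫ ω, φ (U ω) * f ω ∂μ
      = ∫ ω, (μ[(fun ω => φ (U ω)) * f | MeasurableSpace.comap U inferInstance]) ω ∂μ :=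
        (integral_condExp hm).symm
    _ = ∫ ω, c * φ (U ω) ∂μ := by
        refine integral_congr_ae ?_
        filter_upwards [key, h] with ω h1 h2
        rw [h1, Pi.mul_apply, h2, mul_comm]
    _ = _ := integral_const_mul _ _

lemma one_div_vMY {Ω : Type*} {X Y : Ω → ℝ} {ω : Ω} (hx : 0 < X ω) (hy : 0 < Y ω) :
    1 / vMY X Y ω = X ω ^ 2 * (1 / Y ω) + X ω := by
  have h : vMY X Y ω = Y ω / (X ω * (X ω + Y ω)) := by
    rw [vMY, div_sub_div _ _ hx.ne' (by positivity)]
    ring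
  rw [h, one_div_div]
  field_simp

section Regression

variable {Ω : Type*} [MeasurableSpace Ω] {μ : Measure Ω} [IsProbabilityMeasure μ] {X Y : Ω → ℝ}

lemma integrable_one_div_right_of_vMY (hXm : Measurable X) (hYm : Measurable Y)
    (hXpos : ∀ᵐ ω ∂μ, 0 < X ω) (hYpos : ∀ᵐ ω ∂μ, 0 < Y ω) (hindep : IndepFun X Y μ)
    (hVinvint : Integrable (fun ω => 1 / vMY X Y ω) μ) : Integrable (fun ω => 1 / Y ω) μ := by
  have hprod : Integrable (fun ω => X ω ^ 2 * (1 / Y ω)) μ := by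
    refine hVinvint.mono' (by fun_prop) ?_
    filter_upwards [hXpos, hYpos] with ω hx hy
    rw [one_div_vMY hx hy, Real.norm_eq_abs, abs_of_pos (by positivity)]
    linarith
  have hi : IndepFun (fun ω => X ω ^ 2) (fun ω => 1 / Y ω) μ :=
    hindep.comp (φ := fun x => x ^ 2) (ψ := fun y => 1 / y) (by fun_prop) (by fun_prop)
  refine hi.integrable_right_of_integrable_op (fun x y => x * y) 1 one_ne_zero
    (fun x y => by simp [enorm_mul]) hprod (by fun_prop)
    (Measurable.aestronglyMeasurable (by fun_prop)) fun h0 => ?_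
  obtain ⟨ω, h1, h2⟩ := (h0.and hXpos).exists
  exact (pow_pos h2 2).ne' h1

lemma regressionIdentities_of_condExp (hXm : Measurable X) (hYm : Measurable Y)
    (hXpos : ∀ᵐ ω ∂μ, 0 < X ω) (hYpos : ∀ᵐ ω ∂μ, 0 < Y ω) (hindep : IndepFun X Y μ)
    (hXinv : Integrable (fun ω => 1 / X ω) μ) (hYinv : Integrable (fun ω => 1 / Y ω) μ)
    (hVint : Integrable (vMY X Y) μ) (hVinvint : Integrable (fun ω => 1 / vMY X Y ω) μ) {c d : ℝ}
    (hc : μ[vMY X Y | MeasurableSpace.comap (uMY X Y) inferInstance] =ᵐ[μ] fun _ => c)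
    (hd : μ[(fun ω => 1 / vMY X Y ω) |
        MeasurableSpace.comap (uMY X Y) inferInstance] =ᵐ[μ] fun _ => d) :
    RegressionIdentities (invWeightedLaw μ X) (invWeightedLaw μ Y) c d := by
  have hU : Measurable (uMY X Y) := by
    unfold uMY
    fun_prop
  have := isFiniteMeasure_invWeightedLaw hXm hXinv
  have := isFiniteMeasure_invWeightedLaw hYm hYinv
  let P (s : ℝ) (k : ℕ) (x : ℝ) : ℝ := 1 / x * (x ^ k * Real.exp (-(s * x)))
  have hPm : ∀ s k, Measurable (P s k) := fun s k => by fun_prop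
  have hPX : ∀ s, 0 < s → ∀ k, Integrable (fun ω => P s k (X ω)) μ := fun s hs k =>
    (integrable_invWeightedLaw_iff hXm hXpos (by fun_prop)).1
      (integrable_laplaceMoment (invWeightedLaw_pos hXm hXpos) k hs)
  have hPY : ∀ s, 0 < s → ∀ k, Integrable (fun ω => P s k (Y ω)) μ := fun s hs k =>
    (integrable_invWeightedLaw_iff hYm hYpos (by fun_prop)).1
      (integrable_laplaceMoment (invWeightedLaw_pos hYm hYpos) k hs)
  have hind : ∀ s j k, IndepFun (fun ω => P s j (X ω)) (fun ω => P s k (Y ω)) μ :=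
    fun s j k => hindep.comp (hPm s j) (hPm s k)
  have hinteg : ∀ s, 0 < s → ∀ j k, Integrable (fun ω => P s j (X ω) * P s k (Y ω)) μ :=
    fun s hs j k => (hind s j k).integrable_mul (hPX s hs j) (hPY s hs k)
  have hmul : ∀ s, 0 < s → ∀ j k, ∫ ω, P s j (X ω) * P s k (Y ω) ∂μ =
      laplaceMoment (invWeightedLaw μ X) j s * laplaceMoment (invWeightedLaw μ Y) k s := by
    intro s hs j k
    rw [(hind s j k).integral_fun_mul_eq_mul_integral (hPX s hs j).1 (hPY s hs k).1,
      laplaceMoment, laplaceMoment, integral_invWeightedLaw hXm hXpos (by fun_prop),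
      integral_invWeightedLaw hYm hYpos (by fun_prop)]
  refine ⟨fun s hs => ?_, fun s hs => ?_⟩
  · have key := integral_mul_of_condExp_comap_eq_const hU hVint hc
      (φ := fun u => 1 / u * Real.exp (-(s * (1 / u)))) (by fun_prop) (M := 1 / s) ?_
    · have hl : ∫ ω, 1 / uMY X Y ω * Real.exp (-(s * (1 / uMY X Y ω))) * vMY X Y ω ∂μ =
          ∫ ω, P s 0 (X ω) * P s 2 (Y ω) ∂μ := by
        refine integral_congr_ae ?_
        filter_upwards [hXpos, hYpos] with ω hx hy
        simp only [P, uMY, vMY, one_div_one_div]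
        rw [mul_add, neg_add, Real.exp_add, div_sub_div _ _ hx.ne' (by positivity)]
        field_simp
        ring
      have hr : ∫ ω, 1 / uMY X Y ω * Real.exp (-(s * (1 / uMY X Y ω))) ∂μ =
          ∫ ω, (P s 2 (X ω) * P s 1 (Y ω) + P s 1 (X ω) * P s 2 (Y ω)) ∂μ := by
        refine integral_congr_ae ?_
        filter_upwards [hXpos, hYpos] with ω hx hy
        simp only [P, uMY, one_div_one_div]
        rw [mul_add, neg_add, Real.exp_add]
        field_simp
      rw [hl, hr, integral_add (hinteg s hs 2 1) (hinteg s hs 1 2), hmul s hs, hmul s hs,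
        hmul s hs] at key
      exact key
    · filter_upwards [hXpos, hYpos] with ω hx hy
      have hS : 0 < X ω + Y ω := by positivity
      simp only [uMY, one_div_one_div]
      rw [Real.norm_eq_abs, abs_of_pos (by positivity), Real.exp_neg, ← div_eq_mul_inv,
        div_le_div_iff₀ (Real.exp_pos _) hs]
      linarith [Real.add_one_le_exp (s * (X ω + Y ω))]
  · have key := integral_mul_of_condExp_comap_eq_const hU hVinvint hd
      (φ := fun u => Real.exp (-(s * (1 / u)))) (by fun_prop) (M := 1) ?_
    · have hl : ∫ ω, Real.exp (-(s * (1 / uMY X Y ω))) * (1 / vMY X Y ω) ∂μ =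
          ∫ ω, (P s 3 (X ω) * P s 0 (Y ω) + P s 2 (X ω) * P s 1 (Y ω)) ∂μ := by
        refine integral_congr_ae ?_
        filter_upwards [hXpos, hYpos] with ω hx hy
        simp only [P, uMY, one_div_vMY hx hy, one_div_one_div]
        rw [mul_add s, neg_add, Real.exp_add]
        field_simp
      have hr : ∫ ω, Real.exp (-(s * (1 / uMY X Y ω))) ∂μ =
          ∫ ω, P s 1 (X ω) * P s 1 (Y ω) ∂μ := by
        refine integral_congr_ae ?_
        filter_upwards [hXpos, hYpos] with ω hx hy
        simp only [P, uMY, one_div_one_div]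
        rw [mul_add, neg_add, Real.exp_add]
        field_simp
      rw [hl, hr, integral_add (hinteg s hs 3 0) (hinteg s hs 2 1), hmul s hs, hmul s hs,
        hmul s hs] at key
      exact key
    · filter_upwards [hXpos, hYpos] with ω hx hy
      simp only [uMY, one_div_one_div]
      rw [Real.norm_eq_abs, abs_of_pos (Real.exp_pos _), Real.exp_le_one_iff]
      have : 0 < s * (X ω + Y ω) := by positivity
      linarith

end Regression

lemma hasLawGamma_of_laplace {Ω : Type*} [MeasurableSpace Ω] {μ : Measure Ω}
    [IsProbabilityMeasure μ] {Y : Ω → ℝ} (hYm : Measurable Y) (hYpos : ∀ᵐ ω ∂μ, 0 < Y ω)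
    {p a K : ℝ} (hp : 0 < p) (ha : 0 < a) (hK : 0 < K)
    (h : ∀ s, 0 < s → ∫ ω, Real.exp (-(s * Y ω)) ∂μ = K * (s + a) ^ (-p)) :
    HasLawGamma μ Y p a := by
  have hG := Real.Gamma_pos_of_pos hp
  refine hasLawProp_of_laplace hYm hYpos ?_ (fun x hx => if_neg hx.not_gt) ?_ ?_
    (K := K / Real.Gamma p) (by positivity) fun s hs => ?_
  · exact Measurable.ite measurableSet_Ioi (by fun_prop) measurable_const
  · intro x
    unfold gampdf
    split_ifs <;> positivity
  · have := integrableOn_rpow_mul_exp_neg_mul_rpow (s := p - 1) (p := 1) (b := a)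
      (by linarith) one_pos ha
    refine this.congr_fun (fun x hx => ?_) measurableSet_Ioi
    simp [gampdf, show 0 < x from hx]
  · have hsa : 0 < s + a := by positivity
    have : ∫ x in Ioi 0, Real.exp (-(s * x)) * gampdf p a x =
        ∫ x in Ioi 0, x ^ (p - 1) * Real.exp (-((s + a) * x)) := by
      refine setIntegral_congr_fun measurableSet_Ioi fun x hx => ?_
      simp only [gampdf, if_pos (show 0 < x from hx)]
      rw [add_mul, neg_add, Real.exp_add]
      ring
    rw [h s hs, this, Real.integral_rpow_mul_exp_neg_mul_Ioi hp hsa, Real.rpow_neg hsa.le,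
      one_div, Real.inv_rpow hsa.le]
    field_simp

lemma hasLawGIG_of_laplace {Ω : Type*} [MeasurableSpace Ω] {μ : Measure Ω}
    [IsProbabilityMeasure μ] {X : Ω → ℝ} (hXm : Measurable X) (hXpos : ∀ᵐ ω ∂μ, 0 < X ω)
    {p a b K : ℝ} (ha : 0 < a) (hb : 0 < b) (hK : 0 < K)
    (h : ∀ s, 0 < s → ∫ ω, Real.exp (-(s * X ω)) ∂μ =
      K * laplaceMoment (gigKernelMeasure p a b) 1 s) :
    HasLawGIG μ X (-p) (2 * a) (2 * b) := by
  have hpdf : ∀ x, 0 < x → gigpdf (-p) (2 * a) (2 * b) x =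
      x ^ (-p - 1) * Real.exp (-(a * x + b / x)) := by
    intro x hx
    rw [gigpdf, if_pos hx]
    ring_nf
  refine hasLawProp_of_laplace hXm hXpos ?_ (fun x hx => if_neg hx.not_gt) ?_ ?_ hK
    fun s hs => ?_
  · exact Measurable.ite measurableSet_Ioi (by fun_prop) measurable_const
  · intro x
    unfold gigpdf
    split_ifs <;> positivity
  · exact (integrableOn_rpow_mul_exp_gig ha hb _).congr_fun (fun x hx => (hpdf x hx).symm)
      measurableSet_Ioi
  · rw [h s hs, laplaceMoment_gigKernelMeasure]
    congr 1
    refine setIntegral_congr_fun measurableSet_Ioi fun x hx => ?_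
    simp only [hpdf x hx]
    rw [add_mul, add_assoc, neg_add, Real.exp_add, Nat.cast_one,
      show -p - 2 + 1 = -p - 1 by ring]
    ring

/-- Wesołowski: if `V` and `1/V` have constant regression `c`, resp. `d`, on `U`, then
`c·d > 1` and, with `p = cd/(cd-1)` and `b = d/(cd-1)`, there is `a > 0` such that
`X ~ GIG(-p, 2a, 2b)` and `Y ~ Γ(p, a)`. -/
theorem wesolowski_constant_regression
    {Ω : Type*} [MeasurableSpace Ω] (μ : Measure Ω) [IsProbabilityMeasure μ]
    (X Y : Ω → ℝ) (hXm : Measurable X) (hYm : Measurable Y)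
    (hXpos : ∀ᵐ ω ∂μ, 0 < X ω) (hYpos : ∀ᵐ ω ∂μ, 0 < Y ω)
    (hXnd : ¬ ∃ k : ℝ, ∀ᵐ ω ∂μ, X ω = k) (hYnd : ¬ ∃ k : ℝ, ∀ᵐ ω ∂μ, Y ω = k)
    (hindep : IndepFun X Y μ)
    (hXinv : Integrable (fun ω => 1 / X ω) μ)
    (hVint : Integrable (vMY X Y) μ)
    (hVinvint : Integrable (fun ω => 1 / vMY X Y ω) μ)
    (c d : ℝ)
    (hc : μ[vMY X Y | MeasurableSpace.comap (uMY X Y) inferInstance] =ᵐ[μ] fun _ => c)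
    (hd : μ[(fun ω => 1 / vMY X Y ω) |
        MeasurableSpace.comap (uMY X Y) inferInstance] =ᵐ[μ] fun _ => d) :
    1 < c * d ∧ ∃ a : ℝ, 0 < a ∧
      HasLawGIG μ X (-(c * d / (c * d - 1))) (2 * a) (2 * (d / (c * d - 1))) ∧
      HasLawGamma μ Y (c * d / (c * d - 1)) a := by
  have hYinv := integrable_one_div_right_of_vMY hXm hYm hXpos hYpos hindep hVinvint
  have := isFiniteMeasure_invWeightedLaw hXm hXinv
  have := isFiniteMeasure_invWeightedLaw hYm hYinv
  have hX := invWeightedLaw_pos hXm hXpos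
  have hY := invWeightedLaw_pos hYm hYpos
  have hX0 := invWeightedLaw_ne_zero hXm hXpos hXnd
  have hY0 := invWeightedLaw_ne_zero hYm hYpos hYnd
  have hreg := regressionIdentities_of_condExp hXm hYm hXpos hYpos hindep hXinv hYinv hVint
    hVinvint hc hd
  have hcd := hreg.one_lt_mul hX hY hX0 (invWeightedLaw_nondegenerate hYm hYpos hYnd)
  have hd0 := hreg.pos_right hX hY hX0 hY0
  have hcd' : 0 < c * d - 1 := sub_pos.2 hcd
  have hp : 0 < c * d / (c * d - 1) := by positivity
  have hb : 0 < d / (c * d - 1) := by positivity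
  have hconv := fun s (hs : 0 < s) => hreg.log_convexity_eq hX hY hX0 hY0 hs
  have hYid : Integrable (fun x => x) (invWeightedLaw μ Y) := by
    rw [integrable_invWeightedLaw_iff hYm hYpos measurable_id']
    refine (integrable_const (1 : ℝ)).congr ?_
    filter_upwards [hYpos] with ω hω
    field_simp
  obtain ⟨a, ha, hB0⟩ := exists_laplaceMoment_zero_eq_mul hcd hY hY0 hYid hconv
  refine ⟨hcd, a, ha, ?_, ?_⟩
  · have hrec : ∀ s, 0 < s → (s + a) * laplaceMoment (invWeightedLaw μ X) 2 s =
        d / (c * d - 1) * laplaceMoment (invWeightedLaw μ X) 0 s -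
          c * d / (c * d - 1) * laplaceMoment (invWeightedLaw μ X) 1 s := by
      intro s hs
      have h1 := hreg.integrated hX hY hs
      rw [hB0 s hs] at h1
      rw [div_mul_eq_mul_div, div_mul_eq_mul_div, ← sub_div, eq_div_iff hcd'.ne']
      apply mul_right_cancel₀ (laplaceMoment_pos hY hY0 1 hs).ne'
      linear_combination -h1
    have := isFiniteMeasure_gigKernelMeasure (c * d / (c * d - 1)) ha hb
    obtain ⟨K, hK, hKeq⟩ := exists_laplaceMoment_one_eq_mul hX
      (gigKernelMeasure_pos (c * d / (c * d - 1)) a (d / (c * d - 1))) hX0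
      (gigKernelMeasure_ne_zero _ _ _) ha hp hrec
      (fun s hs => laplaceMoment_gigKernelMeasure_recurrence ha hb hp hs)
    refine hasLawGIG_of_laplace hXm hXpos ha hb hK fun s hs => ?_
    rw [← laplaceMoment_one_invWeightedLaw hXm hXpos, hKeq s hs]
  · obtain ⟨K, hK, hKeq⟩ := exists_laplaceMoment_one_eq_rpow hcd ha hY hY0 hconv hB0
    refine hasLawGamma_of_laplace hYm hYpos hp ha hK fun s hs => ?_
    rw [← laplaceMoment_one_invWeightedLaw hYm hYpos, hKeq s hs]
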